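/- Let f : ℝ × ℝⁿ × ℝⁿ → ℝⁿ be continuous, and suppose that for every r > 0 there are positive constants K₀(r), K₁(r), K₂(r), K₃(r), K₄(r) such that ‖f(t,q,v)‖ ≤ K₀ + K₁‖q‖ + K₂‖v‖ + K₃ ‖q‖²/(K₄ + ‖v‖) for every (t,q,v) ∈ [−r,r] × ℝⁿ × ℝⁿ. Then every maximal solution of the second-order equation q̈(t) = f(t, q(t), q̇(t)) is defined on all of ℝ. -/

import Mathlib

open Set Filter MeasureTheory

/-- A solution of the second order ODE `q̈ = f(t, q, q̇)` on a nonempty interval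
`I ⊆ ℝ`, recorded together with its velocity `q'`. -/
def IsSolutionSO {n : ℕ}
    (f : ℝ → EuclideanSpace ℝ (Fin n) → EuclideanSpace ℝ (Fin n) → EuclideanSpace ℝ (Fin n))
    (I : Set ℝ) (q q' : ℝ → EuclideanSpace ℝ (Fin n)) : Prop :=
  I.Nonempty ∧ I.OrdConnected ∧ ∀ t ∈ I,
    HasDerivWithinAt q (q' t) I t ∧ HasDerivWithinAt q' (f t (q t) (q' t)) I t

/-- A maximal solution: a solution admitting no extension to a solution on a
strictly larger interval. -/
def IsMaximalSolutionSO {n : ℕ}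
    (f : ℝ → EuclideanSpace ℝ (Fin n) → EuclideanSpace ℝ (Fin n) → EuclideanSpace ℝ (Fin n))
    (I : Set ℝ) (q q' : ℝ → EuclideanSpace ℝ (Fin n)) : Prop :=
  IsSolutionSO f I q q' ∧
    ∀ J r r', IsSolutionSO f J r r' → I ⊆ J → Set.EqOn q r I → Set.EqOn q' r' I → J = I

open scoped Topology NNReal

lemma isCompact_setOf_lipschitzWith {E X : Type*} [NormedAddCommGroup E] [ProperSpace E]
    [PseudoMetricSpace X] [CompactSpace X] (a : X) (x₀ : E) (M : ℝ≥0) :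
    IsCompact {g : BoundedContinuousFunction X E | g a = x₀ ∧ LipschitzWith M g} := by
  refine BoundedContinuousFunction.arzela_ascoli₂
    (Metric.closedBall x₀ (M * Metric.diam (univ : Set X)))
    (isCompact_closedBall _ _) _ ?_ ?_ ?_
  · have h0 : IsClosed {g : BoundedContinuousFunction X E | g a = x₀} :=
      isClosed_eq (continuous_eval_const a) continuous_const
    have hL : IsClosed {g : BoundedContinuousFunction X E | LipschitzWith M g} :=
      (isClosed_setOfPred_lipschitzWith (α := X) (β := E) M).preimage
        BoundedContinuousFunction.continuous_coe
    exact h0.inter hL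
  · rintro g x ⟨rfl, hg⟩
    refine (hg.dist_le_mul x a).trans ?_
    gcongr
    exact Metric.dist_le_diam_of_mem isCompact_univ.isBounded (mem_univ _) (mem_univ _)
  · exact (LipschitzWith.uniformEquicontinuous _ M fun g => g.2.2).equicontinuous

section Peano

variable {E : Type*} [NormedAddCommGroup E] [NormedSpace ℝ E]

/-- Iterates of the delayed Picard operator `y ↦ x₀ + ∫ s in 0..max (t - δ) 0, F s (y s)`. -/
noncomputable def delayedPicard (F : ℝ → E → E) (x₀ : E) (δ : ℝ) : ℕ → ℝ → E
  | 0 => fun _ => x₀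
  | k + 1 => fun t => x₀ + ∫ s in (0 : ℝ)..max (t - δ) 0, F s (delayedPicard F x₀ δ k s)

lemma lipschitzWith_integral_max {h : ℝ → E} (hh : Continuous h) {M : ℝ≥0} (hM : ∀ s, ‖h s‖ ≤ M)
    (x₀ : E) (δ : ℝ) : LipschitzWith M fun t => x₀ + ∫ s in (0 : ℝ)..max (t - δ) 0, h s := by
  refine LipschitzWith.of_dist_le_mul fun t u => ?_
  rw [dist_add_left, dist_eq_norm, intervalIntegral.integral_interval_sub_left
    (hh.intervalIntegrable _ _) (hh.intervalIntegrable _ _)]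
  refine (intervalIntegral.norm_integral_le_of_norm_le_const fun s _ => hM s).trans ?_
  gcongr
  refine (abs_max_sub_max_le_abs _ _ _).trans_eq ?_
  rw [Real.dist_eq]
  congr 1
  ring

lemma delayedPicard_lipschitzWith {F : ℝ → E → E} (hF : Continuous fun p : ℝ × E => F p.1 p.2)
    {M : ℝ≥0} (hM : ∀ s x, ‖F s x‖ ≤ M) (x₀ : E) (δ : ℝ) (k : ℕ) :
    LipschitzWith M (delayedPicard F x₀ δ k) := by
  induction k with
  | zero => exact (LipschitzWith.const x₀).weaken zero_le
  | succ k ih =>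
    exact lipschitzWith_integral_max (hF.comp (continuous_id.prodMk ih.continuous))
      (fun s => hM _ _) x₀ δ

lemma delayedPicard_succ_eq (F : ℝ → E → E) (x₀ : E) {δ : ℝ} (hδ : 0 < δ) (k : ℕ) :
    ∀ t ≤ (k + 1) * δ, delayedPicard F x₀ δ (k + 1) t = delayedPicard F x₀ δ k t := by
  induction k with
  | zero =>
    intro t ht
    have : max (t - δ) 0 = 0 := max_eq_right (by simpa using ht)
    simp [delayedPicard, this]
  | succ k ih =>
    intro t ht
    refine congrArg (x₀ + ·) (intervalIntegral.integral_congr fun s hs => ?_)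
    rw [uIcc_of_le (le_max_right _ _)] at hs
    have hs' : s ≤ (k + 1) * δ := by
      refine hs.2.trans (max_le ?_ (by positivity))
      push_cast at ht
      linarith
    exact congrArg (F s) (ih s hs')

/-- Tonelli's delayed approximations to the initial value problem `y' = F t y`, `y 0 = x₀`. -/
lemma exists_delayed_solution {F : ℝ → E → E} (hF : Continuous fun p : ℝ × E => F p.1 p.2)
    {M : ℝ≥0} (hM : ∀ s x, ‖F s x‖ ≤ M) (x₀ : E) {δ : ℝ} (hδ : 0 < δ) (T : ℝ) :
    ∃ y : ℝ → E, LipschitzWith M y ∧ y 0 = x₀ ∧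
      ∀ t ≤ T, y t = x₀ + ∫ s in (0 : ℝ)..max (t - δ) 0, F s (y s) := by
  obtain ⟨k, hk⟩ := exists_nat_ge (T / δ)
  have hk' : T ≤ (k + 1) * δ := by
    rw [div_le_iff₀ hδ] at hk
    linarith
  refine ⟨delayedPicard F x₀ δ k, delayedPicard_lipschitzWith hF hM x₀ δ k, ?_, fun t ht => ?_⟩
  · cases k with
    | zero => rfl
    | succ k => simp [delayedPicard, hδ.le]
  · rw [← delayedPicard_succ_eq F x₀ hδ k t (ht.trans hk'), delayedPicard]

/-- Global Peano existence theorem on `[0, 1]` for a bounded continuous vector field. -/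
lemma exists_integral_eq_of_bounded [ProperSpace E] {F : ℝ → E → E}
    (hF : Continuous fun p : ℝ × E => F p.1 p.2) {M : ℝ≥0} (hM : ∀ s x, ‖F s x‖ ≤ M) (x₀ : E) :
    ∃ y : ℝ → E, Continuous y ∧ ∀ t ∈ Icc (0 : ℝ) 1, y t = x₀ + ∫ s in (0 : ℝ)..t, F s (y s) := by
  have hδ (k : ℕ) : (0 : ℝ) < 1 / ((k : ℝ) + 1) := by positivity
  choose y hyL hy0 hy using fun k : ℕ => exists_delayed_solution hF hM x₀ (hδ k) 1
  let g (k : ℕ) : BoundedContinuousFunction (Icc (0 : ℝ) 1) E :=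
    BoundedContinuousFunction.mkOfCompact ⟨(Icc (0 : ℝ) 1).domRestrict (y k),
      (hyL k).continuous.comp continuous_subtype_val⟩
  obtain ⟨z, -, φ, hφ, hz⟩ :=
    (isCompact_setOf_lipschitzWith (⟨0, by simp⟩ : Icc (0 : ℝ) 1) x₀ M).tendsto_subseq (x := g)
      fun k => ⟨hy0 k, (hyL k).comp (LipschitzWith.subtype_val _) |>.weaken (by simp)⟩
  have hlim (t : ℝ) (ht : t ∈ Icc (0 : ℝ) 1) :
      Tendsto (fun k => y (φ k) t) atTop (𝓝 (IccExtend zero_le_one z t)) := by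
    rw [IccExtend_of_mem _ _ ht]
    have heval := continuous_eval_const (F := BoundedContinuousFunction (Icc (0 : ℝ) 1) E) ⟨t, ht⟩
    exact (heval.tendsto z).comp hz
  refine ⟨IccExtend zero_le_one z, z.continuous.Icc_extend', fun t ht => ?_⟩
  have hcont (k : ℕ) : Continuous fun s => F s (y k s) :=
    hF.comp (continuous_id.prodMk (hyL k).continuous)
  have hint : Tendsto (fun k => ∫ s in (0 : ℝ)..t, F s (y (φ k) s)) atTop
      (𝓝 (∫ s in (0 : ℝ)..t, F s (IccExtend zero_le_one z s))) := by
    refine intervalIntegral.tendsto_integral_filter_of_dominated_convergence (fun _ => (M : ℝ))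
      (.of_forall fun k => (hcont _).aestronglyMeasurable) (.of_forall fun k => .of_forall
      fun s _ => hM _ _) intervalIntegrable_const (.of_forall fun s hs => ?_)
    rw [uIoc_of_le ht.1] at hs
    exact (hF.tendsto (s, _)).comp
      (tendsto_const_nhds.prodMk_nhds (hlim s ⟨hs.1.le, hs.2.trans ht.2⟩))
  have herr : Tendsto (fun k => y (φ k) t - (x₀ + ∫ s in (0 : ℝ)..t, F s (y (φ k) s))) atTop
      (𝓝 0) := by
    refine squeeze_zero_norm (a := fun k => M * (1 / ((φ k : ℝ) + 1))) (fun k => ?_) ?_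
    · conv_lhs => rw [hy _ t ht.2]
      rw [add_sub_add_left_eq_sub, intervalIntegral.integral_interval_sub_left
        ((hcont _).intervalIntegrable _ _) ((hcont _).intervalIntegrable _ _)]
      refine (intervalIntegral.norm_integral_le_of_norm_le_const fun s _ => hM _ _).trans ?_
      gcongr
      have := hδ (φ k)
      rw [abs_le]
      constructor
      · linarith [le_max_left (t - 1 / ((φ k : ℝ) + 1)) 0]
      · linarith [max_le (by linarith : t - 1 / ((φ k : ℝ) + 1) ≤ t) ht.1]
    · simpa using (tendsto_one_div_add_atTop_nhds_zero_nat.comp hφ.tendsto_atTop).const_mul (M : ℝ)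
  exact sub_eq_zero.1 (tendsto_nhds_unique ((hlim t ht).sub (tendsto_const_nhds.add hint)) herr)

/-- **Peano existence theorem** (to the right of the initial time). -/
theorem exists_hasDerivWithinAt_Icc_of_continuous [ProperSpace E] {F : ℝ → E → E}
    (hF : Continuous fun p : ℝ × E => F p.1 p.2) (t₀ : ℝ) (x₀ : E) :
    ∃ ε > 0, ∃ y : ℝ → E, y t₀ = x₀ ∧
      ∀ t ∈ Icc t₀ (t₀ + ε), HasDerivWithinAt y (F t (y t)) (Icc t₀ (t₀ + ε)) t := by
  let p (s : ℝ) : ℝ := projIcc (0 : ℝ) 1 zero_le_one s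
  have hp : Continuous p := continuous_subtype_val.comp continuous_projIcc
  let χ (x : E) : ℝ := max 0 (2 - ‖x - x₀‖)
  have hχ : Continuous χ := by fun_prop
  let G (s : ℝ) (x : E) : E := min 1 (χ x) • F (t₀ + p s) x
  have hG : Continuous fun q : ℝ × E => G q.1 q.2 := by
    exact (continuous_const.min (hχ.comp continuous_snd)).smul
      (hF.comp ((continuous_const.add (hp.comp continuous_fst)).prodMk continuous_snd))
  obtain ⟨C, hC⟩ := (isCompact_Icc.prod (isCompact_closedBall x₀ 2)).exists_bound_of_continuousOn
    (s := Icc t₀ (t₀ + 1) ×ˢ Metric.closedBall x₀ 2) hF.continuousOn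
  have hGC (s : ℝ) (x : E) : ‖G s x‖ ≤ C.toNNReal := by
    rcases le_total ‖x - x₀‖ 2 with hx | hx
    · have hps : p s ∈ Icc (0 : ℝ) 1 := (projIcc (0 : ℝ) 1 zero_le_one s).2
      have h := hC (t₀ + p s, x) ⟨⟨by linarith [hps.1], by linarith [hps.2]⟩,
        by rwa [mem_closedBall_iff_norm]⟩
      have h0 : 0 ≤ min 1 (χ x) := le_min zero_le_one (le_max_left _ _)
      rw [norm_smul, Real.norm_of_nonneg h0]
      refine (mul_le_of_le_one_left (norm_nonneg _) (min_le_left _ _)).trans ?_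
      exact h.trans (Real.le_coe_toNNReal C)
    · have : χ x = 0 := max_eq_left (by linarith)
      simp [G, this]
  obtain ⟨y, hyc, hy⟩ := exists_integral_eq_of_bounded hG hGC x₀
  have hy0 : y 0 = x₀ := by simpa using hy 0 (by simp)
  obtain ⟨ε, hε, hball⟩ := Metric.continuous_iff.1 hyc 0 1 one_pos
  have hmin : 0 < min (ε / 2) 1 := lt_min (by linarith) one_pos
  refine ⟨min (ε / 2) 1, hmin, fun t => y (t - t₀), by simpa using hy0, fun t ht => ?_⟩
  have hmem : ∀ u ∈ Icc t₀ (t₀ + min (ε / 2) 1), u - t₀ ∈ Icc (0 : ℝ) 1 := fun u hu =>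
    ⟨by linarith [hu.1], by linarith [hu.2, min_le_right (ε / 2) 1]⟩
  have hGF : G (t - t₀) (y (t - t₀)) = F t (y (t - t₀)) := by
    have hd : ‖y (t - t₀) - x₀‖ < 1 := by
      rw [← dist_eq_norm, ← hy0]
      refine hball _ ?_
      rw [Real.dist_eq, sub_zero, abs_of_nonneg (hmem t ht).1]
      linarith [ht.2, min_le_left (ε / 2) 1]
    have h1 : min 1 (χ (y (t - t₀))) = 1 :=
      min_eq_left ((by linarith : (1 : ℝ) ≤ 2 - ‖y (t - t₀) - x₀‖).trans (le_max_right _ _))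
    have h2 : p (t - t₀) = t - t₀ := congrArg Subtype.val (projIcc_of_mem zero_le_one (hmem t ht))
    simp only [G, h1, h2, one_smul, add_sub_cancel]
  have hder : HasDerivAt (fun u => x₀ + ∫ s in (0 : ℝ)..(u - t₀), G s (y s))
      (F t (y (t - t₀))) t := by
    rw [← hGF]
    have hc : Continuous fun s => G s (y s) := hG.comp (continuous_id.prodMk hyc)
    exact ((hc.integral_hasStrictDerivAt 0 (t - t₀)).hasDerivAt.comp_sub_const t t₀).const_add x₀
  exact hder.hasDerivWithinAt.congr (fun u hu => hy _ (hmem u hu)) (hy _ (hmem t ht))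

end Peano

section SecondOrder

lemma exists_tendsto_nhdsLT_of_deriv_bounded {E : Type*} [NormedAddCommGroup E] [NormedSpace ℝ E]
    [CompleteSpace E] {y y' : ℝ → E} {a b C : ℝ} (hab : a < b)
    (hy : ∀ t ∈ Ico a b, HasDerivWithinAt y (y' t) (Ico a b) t) (hC : ∀ t ∈ Ico a b, ‖y' t‖ ≤ C) :
    ∃ L, Tendsto y (𝓝[<] b) (𝓝 L) := by
  have hL : LipschitzOnWith C.toNNReal y (Ico a b) :=
    (convex_Ico a b).lipschitzOnWith_of_nnnorm_hasDerivWithin_le hy fun t ht =>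
      NNReal.coe_le_coe.1 ((hC t ht).trans (Real.le_coe_toNNReal C))
  rw [← nhdsWithin_Ico_eq_nhdsLT hab]
  have : (𝓝[Ico a b] b).NeBot := by
    rw [nhdsWithin_Ico_eq_nhdsLT hab]
    infer_instance
  refine cauchy_map_iff_exists_tendsto.1 ?_
  exact (cauchy_nhds.mono nhdsWithin_le_nhds).map_of_le hL.uniformContinuousOn inf_le_right

lemma hasDerivWithinAt_update_Iic {E : Type*} [NormedAddCommGroup E] [NormedSpace ℝ E]
    {y y' : ℝ → E} {a b : ℝ} {L L' : E} (hab : a < b)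
    (hy : ∀ t ∈ Ico a b, HasDerivWithinAt y (y' t) (Ico a b) t)
    (hL : Tendsto y (𝓝[<] b) (𝓝 L)) (hL' : Tendsto y' (𝓝[<] b) (𝓝 L')) :
    HasDerivWithinAt (Function.update y b L) L' (Iic b) b := by
  have hd : ∀ t ∈ Ioo a b, HasDerivAt (Function.update y b L) (y' t) t := fun t ht =>
    ((hy t ⟨ht.1.le, ht.2⟩).hasDerivAt (Ico_mem_nhds ht.1 ht.2)).congr_of_eventuallyEq
      ((eventually_ne_nhds ht.2.ne).mono fun s hs => Function.update_of_ne hs _ _)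
  refine hasDerivWithinAt_Iic_of_tendsto_deriv (s := Ioo a b)
    (fun t ht => (hd t ht).differentiableAt.differentiableWithinAt) ?_ (Ioo_mem_nhdsLT hab) ?_
  · rw [continuousWithinAt_update_same]
    refine hL.mono_left (nhdsWithin_mono _ fun t ht => ht.1.2)
  · exact hL'.congr' (mem_of_superset (Ioo_mem_nhdsLT hab) fun t ht => (hd t ht).deriv.symm)

lemma hasDerivWithinAt_piecewise_union {E : Type*} [NormedAddCommGroup E] [NormedSpace ℝ E]
    {u y u' y' : ℝ → E} {I K : Set ℝ} {b : ℝ} (hI : I ⊆ Iic b) (hK : K ⊆ Ici b)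
    (hbI : b ∈ I) (hbK : b ∈ K) (huy : u b = y b) (huy' : u' b = y' b)
    (hu : ∀ t ∈ I, HasDerivWithinAt u (u' t) I t) (hy : ∀ t ∈ K, HasDerivWithinAt y (y' t) K t) :
    ∀ t ∈ I ∪ K, HasDerivWithinAt (fun s => if s ≤ b then u s else y s)
      (if t ≤ b then u' t else y' t) (I ∪ K) t := by
  have hK_eq : ∀ {u y : ℝ → E}, u b = y b → ∀ t ∈ K, (if t ≤ b then u t else y t) = y t := by
    intro u y h t ht
    split_ifs with htb
    · rw [le_antisymm htb (hK ht), h]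
    · rfl
  have hI_eq : ∀ {u y : ℝ → E}, ∀ t ∈ I, (if t ≤ b then u t else y t) = u t :=
    fun t ht => if_pos (hI ht)
  intro t ht
  refine HasDerivWithinAt.union ?_ ?_
  · by_cases htb : t ≤ b
    · have htI : t ∈ I := ht.elim id fun h => le_antisymm htb (hK h) ▸ hbI
      rw [hI_eq t htI]
      exact (hu t htI).congr hI_eq (hI_eq t htI)
    · exact HasFDerivWithinAt.of_notMem_closure fun h => htb (closure_minimal hI isClosed_Iic h)
  · by_cases htb : b ≤ t
    · have htK : t ∈ K := ht.elim (fun h => le_antisymm (hI h) htb ▸ hbK) id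
      rw [hK_eq huy' t htK]
      exact (hy t htK).congr (hK_eq huy) (hK_eq huy t htK)
    · exact HasFDerivWithinAt.of_notMem_closure fun h => htb (closure_minimal hK isClosed_Ici h)

lemma hasDerivWithinAt_comp_neg {E : Type*} [NormedAddCommGroup E] [NormedSpace ℝ E]
    {y : ℝ → E} {d : E} {I : Set ℝ} {t : ℝ} (hy : HasDerivWithinAt y d I (-t)) :
    HasDerivWithinAt (fun s => y (-s)) (-d) (Neg.neg ⁻¹' I) t := by
  simpa [Function.comp_def] using
    hy.scomp t (hasDerivAt_neg t).hasDerivWithinAt (mapsTo_preimage _ _)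

variable {n : ℕ}
  {f : ℝ → EuclideanSpace ℝ (Fin n) → EuclideanSpace ℝ (Fin n) → EuclideanSpace ℝ (Fin n)}
  {I : Set ℝ} {q q' : ℝ → EuclideanSpace ℝ (Fin n)}

lemma IsSolutionSO.mono {J : Set ℝ} (hq : IsSolutionSO f I q q') (hJ : J.Nonempty)
    (hJc : J.OrdConnected) (hJI : J ⊆ I) : IsSolutionSO f J q q' :=
  ⟨hJ, hJc, fun t ht => ⟨(hq.2.2 t (hJI ht)).1.mono hJI, (hq.2.2 t (hJI ht)).2.mono hJI⟩⟩

/-- Gronwall estimate: the power bound `‖v‖ ‖f‖ ≤ C (1 + ‖x‖² + ‖v‖²)` prevents blow-up. -/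
lemma IsSolutionSO.exists_norm_le {a b C : ℝ} (hq : IsSolutionSO f (Ico a b) q q')
    (hC : ∀ t ∈ Ico a b, ∀ x v, ‖v‖ * ‖f t x v‖ ≤ C * (1 + ‖x‖ ^ 2 + ‖v‖ ^ 2)) :
    ∃ R, ∀ t ∈ Ico a b, ‖q t‖ ≤ R ∧ ‖q' t‖ ≤ R := by
  let e (t : ℝ) : ℝ := 1 + ‖q t‖ ^ 2 + ‖q' t‖ ^ 2
  let e' (t : ℝ) : ℝ := 2 * inner ℝ (q t) (q' t) + 2 * inner ℝ (q' t) (f t (q t) (q' t))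
  have he_pos (t : ℝ) : 0 < e t := by positivity
  have he (t : ℝ) (ht : t ∈ Ico a b) : HasDerivWithinAt e (e' t) (Ico a b) t :=
    ((hq.2.2 t ht).1.norm_sq.const_add 1).add (hq.2.2 t ht).2.norm_sq
  have he' (t : ℝ) (ht : t ∈ Ico a b) : ‖e' t‖ ≤ (1 + 2 * |C|) * ‖e t‖ + 0 := by
    rw [Real.norm_of_nonneg (he_pos t).le, add_zero]
    have h1 := abs_real_inner_le_norm (q t) (q' t)
    have h2 := (abs_real_inner_le_norm (q' t) (f t (q t) (q' t))).trans (hC t ht (q t) (q' t))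
    have h3 : C * e t ≤ |C| * e t := by
      exact mul_le_mul_of_nonneg_right (le_abs_self C) (he_pos t).le
    calc ‖e' t‖ ≤ 2 * |inner ℝ (q t) (q' t)| + 2 * |inner ℝ (q' t) (f t (q t) (q' t))| := by
          refine (norm_add_le _ _).trans_eq ?_
          simp
      _ ≤ 2 * (‖q t‖ * ‖q' t‖) + 2 * (|C| * e t) := by
          gcongr
          exact h2.trans h3
      _ ≤ (1 + 2 * |C|) * e t := by
          have := sq_nonneg (‖q t‖ - ‖q' t‖)
          simp only [e]
          nlinarith
  have hbound (t : ℝ) (ht : t ∈ Ico a b) : e t ≤ gronwallBound (e a) (1 + 2 * |C|) 0 (b - a) := by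
    have hsub : Icc a t ⊆ Ico a b := Icc_subset_Ico_right ht.2
    have h := norm_le_gronwallBound_of_norm_deriv_right_le (f := e) (f' := e')
      (fun s hs => (he s (hsub hs)).continuousWithinAt.mono hsub)
      (fun s hs => (he s (hsub (Ico_subset_Icc_self hs))).mono_of_mem_nhdsWithin
        (mem_of_superset (Ico_mem_nhdsGE (hs.2.trans ht.2)) (Ico_subset_Ico_left hs.1)))
      (Real.norm_of_nonneg (he_pos a).le).le
      (fun s hs => he' s (hsub (Ico_subset_Icc_self hs))) t (right_mem_Icc.2 ht.1)
    rw [Real.norm_of_nonneg (he_pos t).le] at h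
    exact h.trans (gronwallBound_mono (he_pos a).le le_rfl (by positivity) (by linarith [ht.2]))
  refine ⟨gronwallBound (e a) (1 + 2 * |C|) 0 (b - a), fun t ht => ?_⟩
  have h := hbound t ht
  simp only [e] at h
  constructor
  · nlinarith [sq_nonneg (‖q t‖ - 1), sq_nonneg ‖q' t‖]
  · nlinarith [sq_nonneg (‖q' t‖ - 1), sq_nonneg ‖q t‖]

lemma IsMaximalSolutionSO.notMem_of_mem_upperBounds
    (hf : Continuous fun p : ℝ × EuclideanSpace ℝ (Fin n) × EuclideanSpace ℝ (Fin n) =>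
      f p.1 p.2.1 p.2.2) (hq : IsMaximalSolutionSO f I q q') {b : ℝ} (hb : b ∈ upperBounds I) :
    b ∉ I := by
  intro hbI
  obtain ⟨ε, hε, y, hyb, hy⟩ := exists_hasDerivWithinAt_Icc_of_continuous
    (F := fun t (z : EuclideanSpace ℝ (Fin n) × EuclideanSpace ℝ (Fin n)) => (z.2, f t z.1 z.2))
    ((continuous_snd.comp continuous_snd).prodMk hf) b (q b, q' b)
  have hbK : b ∈ Icc b (b + ε) := ⟨le_rfl, by linarith⟩
  have hr := hasDerivWithinAt_piecewise_union (u := q) (y := fun t => (y t).1) (u' := q')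
    (y' := fun t => (y t).2) hb Icc_subset_Ici_self hbI hbK (by simp [hyb]) (by simp [hyb])
    (fun t ht => (hq.1.2.2 t ht).1) (fun t ht => (hy t ht).fst)
  have hr' := hasDerivWithinAt_piecewise_union (u := q') (y := fun t => (y t).2)
    (u' := fun t => f t (q t) (q' t)) (y' := fun t => f t (y t).1 (y t).2) hb Icc_subset_Ici_self
    hbI hbK (by simp [hyb]) (by simp [hyb])
    (fun t ht => (hq.1.2.2 t ht).2) (fun t ht => (hy t ht).snd)
  have hJ := hq.2 (I ∪ Icc b (b + ε)) (fun s => if s ≤ b then q s else (y s).1)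
    (fun s => if s ≤ b then q' s else (y s).2)
    ⟨⟨b, .inl hbI⟩, (hq.1.2.1.isPreconnected.union b hbI hbK isPreconnected_Icc).ordConnected,
      fun t ht =>
      by
      have h := hr' t ht
      refine ⟨hr t ht, ?_⟩
      beta_reduce
      split_ifs at h ⊢ <;> exact h⟩
    subset_union_left (fun t ht => (if_pos (hb ht)).symm) (fun t ht => (if_pos (hb ht)).symm)
  have hmem : b + ε ∈ I := hJ.subset (.inr ⟨by linarith, le_rfl⟩)
  linarith [hb hmem]

theorem IsMaximalSolutionSO.not_bddAbove
    (hf : Continuous fun p : ℝ × EuclideanSpace ℝ (Fin n) × EuclideanSpace ℝ (Fin n) =>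
      f p.1 p.2.1 p.2.2)
    (hpow : ∀ r > (0 : ℝ), ∃ C, ∀ t ∈ Icc (-r) r, ∀ x v,
      ‖v‖ * ‖f t x v‖ ≤ C * (1 + ‖x‖ ^ 2 + ‖v‖ ^ 2))
    (hq : IsMaximalSolutionSO f I q q') : ¬ BddAbove I := by
  intro hbdd
  obtain ⟨a, ha⟩ := hq.1.1
  set b := sSup I
  have hb : IsLUB I b := isLUB_csSup ⟨a, ha⟩ hbdd
  have hbI : b ∉ I := hq.notMem_of_mem_upperBounds hf hb.1
  have hlt : ∀ t ∈ I, t < b := fun t ht => (hb.1 ht).lt_of_ne fun h => hbI (h ▸ ht)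
  have hab := hlt a ha
  have hIco : ∀ s ∈ I, Ico s b ⊆ I := fun s hs t ht => by
    obtain ⟨w, hw, htw, -⟩ := hb.exists_between ht.2
    exact hq.1.2.1.out hs hw ⟨ht.1, htw.le⟩
  have hsol := hq.1.mono (nonempty_Ico.2 hab) ordConnected_Ico (hIco a ha)
  obtain ⟨C, hC⟩ := hpow (|a| + |b| + 1) (by positivity)
  obtain ⟨R, hR⟩ := hsol.exists_norm_le fun t ht => hC t
    ⟨by linarith [ht.1, neg_abs_le a, abs_nonneg b],
      by linarith [ht.2, le_abs_self b, abs_nonneg a]⟩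
  obtain ⟨M, hM⟩ := (isCompact_Icc.prod ((isCompact_closedBall 0 R).prod
    (isCompact_closedBall 0 R))).exists_bound_of_continuousOn (s := Icc a b ×ˢ
      (Metric.closedBall (0 : EuclideanSpace ℝ (Fin n)) R ×ˢ
        Metric.closedBall (0 : EuclideanSpace ℝ (Fin n)) R)) hf.continuousOn
  obtain ⟨L, hL⟩ := exists_tendsto_nhdsLT_of_deriv_bounded hab (fun t ht => (hsol.2.2 t ht).1)
    fun t ht => (hR t ht).2
  obtain ⟨L', hL'⟩ := exists_tendsto_nhdsLT_of_deriv_bounded hab (fun t ht => (hsol.2.2 t ht).2)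
    fun t ht => hM (t, q t, q' t) ⟨Ico_subset_Icc_self ht, by simpa using hR t ht⟩
  have hfL : Tendsto (fun t => f t (q t) (q' t)) (𝓝[<] b) (𝓝 (f b L L')) :=
    (hf.tendsto (b, L, L')).comp
      ((tendsto_id.mono_left nhdsWithin_le_nhds).prodMk_nhds (hL.prodMk_nhds hL'))
  have heq (g : ℝ → EuclideanSpace ℝ (Fin n)) (l : EuclideanSpace ℝ (Fin n)) :
      EqOn g (Function.update g b l) I := fun t ht => (Function.update_of_ne (hlt t ht).ne _ _).symm
  have hJ := hq.2 (insert b I) (Function.update q b L) (Function.update q' b L')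
    ⟨insert_nonempty b I, ⟨?_⟩, ?_⟩ (subset_insert b I) (heq q L) (heq q' L')
  · exact hbI (hJ ▸ mem_insert b I)
  · intro x hx y hy z hz
    have hzb : z ≤ b := hz.2.trans (hy.elim Eq.le fun h => hb.1 h)
    rcases hzb.eq_or_lt with rfl | hzb
    · exact mem_insert _ _
    · exact .inr (hIco x (hx.resolve_left fun h => by linarith [hz.1]) ⟨hz.1, hzb⟩)
  · have hJ_sub : insert b I ⊆ Iic b := insert_subset self_mem_Iic hb.1
    rintro t (rfl | ht)
    · simp only [Function.update_self]
      exact ⟨(hasDerivWithinAt_update_Iic hab (fun t ht => (hsol.2.2 t ht).1) hL hL').mono hJ_sub,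
        (hasDerivWithinAt_update_Iic hab (fun t ht => (hsol.2.2 t ht).2) hL' hfL).mono hJ_sub⟩
    · rw [← heq q L ht, ← heq q' L' ht]
      exact ⟨HasFDerivWithinAt.insert' <| (hq.1.2.2 t ht).1.congr
          (fun s hs => (heq q L hs).symm) (heq q L ht).symm,
        HasFDerivWithinAt.insert' <| (hq.1.2.2 t ht).2.congr
          (fun s hs => (heq q' L' hs).symm) (heq q' L' ht).symm⟩

lemma IsSolutionSO.comp_neg (hq : IsSolutionSO f I q q') :
    IsSolutionSO (fun t x v => f (-t) x (-v)) (Neg.neg ⁻¹' I) (fun t => q (-t))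
      (fun t => -q' (-t)) := by
  obtain ⟨⟨a, ha⟩, hI, hd⟩ := hq
  refine ⟨⟨-a, by simpa using ha⟩, ⟨fun x hx y hy z hz => ?_⟩, fun t ht => ?_⟩
  · exact hI.out hy hx ⟨neg_le_neg hz.2, neg_le_neg hz.1⟩
  · refine ⟨hasDerivWithinAt_comp_neg (hd _ ht).1, ?_⟩
    simpa only [neg_neg] using (hasDerivWithinAt_comp_neg (hd _ ht).2).fun_neg

lemma IsMaximalSolutionSO.comp_neg (hq : IsMaximalSolutionSO f I q q') :
    IsMaximalSolutionSO (fun t x v => f (-t) x (-v)) (Neg.neg ⁻¹' I) (fun t => q (-t))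
      (fun t => -q' (-t)) := by
  refine ⟨hq.1.comp_neg, fun J r r' hr hIJ hqr hqr' => ?_⟩
  have hJ := hq.2 (Neg.neg ⁻¹' J) (fun t => r (-t)) (fun t => -r' (-t))
    (by simpa using hr.comp_neg) (fun t ht => hIJ (by simpa using ht))
    (fun t ht => by simpa using hqr (x := -t) (by simpa using ht))
    (fun t ht => by simpa using congrArg Neg.neg (hqr' (x := -t) (by simpa using ht)))
  rw [← hJ]
  ext t
  simp

/-- A maximal solution of a second order equation whose force satisfies the power bound
`‖v‖ ‖f‖ ≤ C (1 + ‖x‖² + ‖v‖²)`, locally uniformly in time, is global. -/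
theorem IsMaximalSolutionSO.eq_univ
    (hf : Continuous fun p : ℝ × EuclideanSpace ℝ (Fin n) × EuclideanSpace ℝ (Fin n) =>
      f p.1 p.2.1 p.2.2)
    (hpow : ∀ r > (0 : ℝ), ∃ C, ∀ t ∈ Icc (-r) r, ∀ x v,
      ‖v‖ * ‖f t x v‖ ≤ C * (1 + ‖x‖ ^ 2 + ‖v‖ ^ 2))
    (hq : IsMaximalSolutionSO f I q q') : I = univ := by
  have habove := hq.not_bddAbove hf hpow
  have hrev : Continuous fun p : ℝ × EuclideanSpace ℝ (Fin n) × EuclideanSpace ℝ (Fin n) =>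
      (-p.1, p.2.1, -p.2.2) := by fun_prop
  have hbelow := IsMaximalSolutionSO.not_bddAbove (f := fun t x v => f (-t) x (-v)) (hf.comp hrev)
    (fun r hr => (hpow r hr).imp fun C hC t ht x v => by
      simpa using hC (-t) ⟨neg_le_neg ht.2, neg_le.1 ht.1⟩ x (-v)) hq.comp_neg
  rw [not_bddAbove_iff] at habove hbelow
  refine eq_univ_of_forall fun t => ?_
  obtain ⟨y, hy, hty⟩ := habove t
  obtain ⟨x, hx, htx⟩ := hbelow (-t)
  exact hq.1.2.1.out hx hy ⟨by linarith, hty.le⟩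

end SecondOrder

lemma mul_quadratic_growth_le {K₀ K₁ K₂ K₃ K₄ x v : ℝ} (h₀ : 0 ≤ K₀) (h₁ : 0 ≤ K₁) (h₂ : 0 ≤ K₂)
    (h₃ : 0 ≤ K₃) (h₄ : 0 < K₄) (hv : 0 ≤ v) :
    v * (K₀ + K₁ * x + K₂ * v + K₃ * x ^ 2 / (K₄ + v)) ≤
      (K₀ + K₁ + K₂ + K₃) * (1 + x ^ 2 + v ^ 2) := by
  have hfrac : v * (K₃ * x ^ 2 / (K₄ + v)) ≤ K₃ * x ^ 2 := by
    rw [mul_div_assoc', div_le_iff₀ (by positivity), mul_comm v]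
    gcongr
    linarith
  have e₀ : v * K₀ ≤ K₀ * (1 + x ^ 2 + v ^ 2) := by
    rw [mul_comm]
    gcongr
    nlinarith [sq_nonneg (v - 1)]
  have e₁ : v * (K₁ * x) ≤ K₁ * (1 + x ^ 2 + v ^ 2) := by
    rw [mul_left_comm]
    gcongr
    nlinarith [sq_nonneg (v - x)]
  have e₂ : v * (K₂ * v) ≤ K₂ * (1 + x ^ 2 + v ^ 2) := by
    rw [mul_left_comm]
    gcongr
    nlinarith
  have e₃ : K₃ * x ^ 2 ≤ K₃ * (1 + x ^ 2 + v ^ 2) := by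
    gcongr
    nlinarith
  linarith

/-- **Concrete growth bound ensuring completeness of second-order ODE flows.**
If `f` is continuous and for every `r > 0` there are positive constants
`K₀,…,K₄` with `‖f(t,q,v)‖ ≤ K₀ + K₁‖q‖ + K₂‖v‖ + K₃‖q‖²/(K₄+‖v‖)` on
`[-r,r] × ℝⁿ × ℝⁿ`, then every maximal solution of `q̈ = f(t,q,q̇)` is defined
on all of `ℝ`. -/
theorem second_order_completeness_concrete {n : ℕ}
    (f : ℝ → EuclideanSpace ℝ (Fin n) → EuclideanSpace ℝ (Fin n) → EuclideanSpace ℝ (Fin n))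
    (hf : Continuous fun p : ℝ × EuclideanSpace ℝ (Fin n) × EuclideanSpace ℝ (Fin n) =>
      f p.1 p.2.1 p.2.2)
    (hbound : ∀ r > (0:ℝ), ∃ K₀ > (0:ℝ), ∃ K₁ > (0:ℝ), ∃ K₂ > (0:ℝ),
      ∃ K₃ > (0:ℝ), ∃ K₄ > (0:ℝ),
      ∀ t ∈ Icc (-r) r, ∀ x v : EuclideanSpace ℝ (Fin n),
        ‖f t x v‖ ≤ K₀ + K₁ * ‖x‖ + K₂ * ‖v‖ + K₃ * ‖x‖ ^ 2 / (K₄ + ‖v‖))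
    (I : Set ℝ) (q q' : ℝ → EuclideanSpace ℝ (Fin n))
    (hq : IsMaximalSolutionSO f I q q') : I = Set.univ := by
  refine hq.eq_univ hf fun r hr => ?_
  obtain ⟨K₀, h₀, K₁, h₁, K₂, h₂, K₃, h₃, K₄, h₄, hK⟩ := hbound r hr
  refine ⟨K₀ + K₁ + K₂ + K₃, fun t ht x v => ?_⟩
  exact (mul_le_mul_of_nonneg_left (hK t ht x v) (norm_nonneg v)).trans
    (mul_quadratic_growth_le h₀.le h₁.le h₂.le h₃.le h₄ (norm_nonneg v))
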